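/- There exists N such that for all n ≥ N the following holds: if V is a linear subspace of 𝔽₂^n (equivalently, a family of vectors in {0,1}^n closed under coordinatewise addition modulo 2) of dimension at least 0.44n, then V contains 4 distinct vectors forming a focal family of size 4. -/

import Mathlib

/-- A family consisting of a focus vector `x₀` and `m` further vectors `xs 0, …, xs (m-1)`
in `α^n` is *focal with focus `x₀`* if for every coordinate `i`, at most one of the
vectors `xs j` differs from `x₀` at `i` (equivalently, at least `m - 1` of the `m`
entries `xs j i` are equal to `x₀ i`). -/
def IsFocalWithFocus {α : Type*} {n m : ℕ} (x₀ : Fin n → α) (xs : Fin m → Fin n → α) : Prop :=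
  ∀ i : Fin n, ∀ j j' : Fin m, xs j i ≠ x₀ i → xs j' i ≠ x₀ i → j = j'

open Finset

/-- The nontrivial real character of `ZMod 2`. -/
noncomputable def zmodTwoSign (a : ZMod 2) : ℝ := if a = 0 then 1 else -1

lemma zmodTwoSign_zero : zmodTwoSign 0 = 1 := by simp [zmodTwoSign]

lemma zmodTwoSign_add (a b : ZMod 2) :
    zmodTwoSign (a + b) = zmodTwoSign a * zmodTwoSign b := by
  have h : ∀ a : ZMod 2, a = 0 ∨ a = 1 := by decide
  have h2 : (1 : ZMod 2) + 1 = 0 := by decide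
  rcases h a with rfl | rfl <;> rcases h b with rfl | rfl <;> simp [zmodTwoSign, h2]

lemma zmodTwoSign_eq_one_or (a : ZMod 2) : zmodTwoSign a = 1 ∨ zmodTwoSign a = -1 := by
  unfold zmodTwoSign
  split_ifs <;> simp

section Walsh

variable {ι : Type*} [Fintype ι]

lemma sum_zmodTwoSign (y : ι → ZMod 2) :
    ∑ i, zmodTwoSign (y i) = Fintype.card ι - 2 * (hammingNorm y : ℝ) := by
  have h : ∀ i, zmodTwoSign (y i) = 1 - 2 * (if y i ≠ 0 then (1 : ℝ) else 0) := fun i => by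
    unfold zmodTwoSign
    split_ifs <;> first | contradiction | norm_num
  simp only [h, Finset.sum_sub_distrib, ← Finset.mul_sum, Finset.sum_boole]
  simp [hammingNorm]

lemma sum_zmodTwoSign_dotProduct_nonneg (C : Submodule (ZMod 2) (ι → ZMod 2)) [Fintype C]
    (z : ι → ZMod 2) : 0 ≤ ∑ c : C, zmodTwoSign (z ⬝ᵥ (c : ι → ZMod 2)) := by
  by_cases h : ∃ c₀ : C, zmodTwoSign (z ⬝ᵥ (c₀ : ι → ZMod 2)) = -1
  · obtain ⟨c₀, h₀⟩ := h
    have hs := Equiv.sum_comp (Equiv.addRight c₀)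
      fun c : C => zmodTwoSign (z ⬝ᵥ (c : ι → ZMod 2))
    simp only [Equiv.coe_addRight, Submodule.coe_add, dotProduct_add, zmodTwoSign_add, h₀,
      ← Finset.sum_mul] at hs
    linarith
  · push Not at h
    refine Finset.sum_nonneg fun c _ => ?_
    rw [(zmodTwoSign_eq_one_or _).resolve_right (h c)]
    exact zero_le_one

lemma exists_hammingNorm_eq {r : ℕ} (hr : r ≤ Fintype.card ι) :
    ∃ x : ι → ZMod 2, hammingNorm x = r := by
  classical
  obtain ⟨s, -, hs⟩ := Finset.exists_subset_card_eq (s := (Finset.univ : Finset ι)) hr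
  exact ⟨fun i => if i ∈ s then 1 else 0, by simp [hammingNorm, hs]⟩

variable [DecidableEq ι]

/-- The Walsh–Hadamard transform of a real function on `𝔽₂^ι`. -/
noncomputable def walsh (f : (ι → ZMod 2) → ℝ) (y : ι → ZMod 2) : ℝ :=
  ∑ x, f x * zmodTwoSign (x ⬝ᵥ y)

/-- The adjacency operator of the hypercube graph on `𝔽₂^ι`. -/
noncomputable def cubeAdj (f : (ι → ZMod 2) → ℝ) (x : ι → ZMod 2) : ℝ :=
  ∑ i, f (x + Pi.single i 1)

lemma walsh_zero (f : (ι → ZMod 2) → ℝ) : walsh f 0 = ∑ x, f x := by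
  simp [walsh, zmodTwoSign_zero]

lemma walsh_shift (f : (ι → ZMod 2) → ℝ) (v y : ι → ZMod 2) :
    walsh (fun x => f (x + v)) y = zmodTwoSign (v ⬝ᵥ y) * walsh f y := by
  have hv : v + v = 0 := by
    ext i; exact CharTwo.add_self_eq_zero (v i)
  unfold walsh
  rw [← Equiv.sum_comp (Equiv.addRight v), Finset.mul_sum]
  refine Finset.sum_congr rfl fun x _ => ?_
  simp only [Equiv.coe_addRight, add_assoc, hv, add_zero, add_dotProduct, zmodTwoSign_add]
  ring

lemma walsh_cubeAdj (f : (ι → ZMod 2) → ℝ) (y : ι → ZMod 2) :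
    walsh (cubeAdj f) y = (Fintype.card ι - 2 * (hammingNorm y : ℝ)) * walsh f y := by
  have h : walsh (cubeAdj f) y = ∑ i, walsh (fun x => f (x + Pi.single i 1)) y := by
    simp only [walsh, cubeAdj, Finset.sum_mul]
    exact Finset.sum_comm
  rw [h, ← sum_zmodTwoSign, Finset.sum_mul]
  refine Finset.sum_congr rfl fun i _ => ?_
  rw [walsh_shift, single_one_dotProduct]

lemma sum_walsh_mul_walsh (C : Submodule (ZMod 2) (ι → ZMod 2)) [Fintype C]
    (f g : (ι → ZMod 2) → ℝ) :
    ∑ c : C, walsh f c * walsh g c =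
      ∑ x, ∑ y, f x * g y * ∑ c : C, zmodTwoSign ((x + y) ⬝ᵥ (c : ι → ZMod 2)) := by
  simp only [walsh, Finset.sum_mul_sum, add_dotProduct, zmodTwoSign_add]
  simp only [Finset.mul_sum]
  rw [Finset.sum_comm]
  refine Finset.sum_congr rfl fun x _ => ?_
  rw [Finset.sum_comm]
  refine Finset.sum_congr rfl fun y _ => Finset.sum_congr rfl fun c _ => ?_
  ring

lemma sum_walsh_mul_walsh_mono (C : Submodule (ZMod 2) (ι → ZMod 2)) [Fintype C]
    {f g h : (ι → ZMod 2) → ℝ} (hf : ∀ x, 0 ≤ f x) (hgh : ∀ x, g x ≤ h x) :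
    ∑ c : C, walsh f c * walsh g c ≤ ∑ c : C, walsh f c * walsh h c := by
  rw [sum_walsh_mul_walsh, sum_walsh_mul_walsh]
  refine Finset.sum_le_sum fun x _ => Finset.sum_le_sum fun y _ => ?_
  exact mul_le_mul_of_nonneg_right (mul_le_mul_of_nonneg_left (hgh y) (hf x))
    (sum_zmodTwoSign_dotProduct_nonneg C _)

lemma card_mul_sum_sq_le_sum_walsh_sq (C : Submodule (ZMod 2) (ι → ZMod 2)) [Fintype C]
    {f : (ι → ZMod 2) → ℝ} (hf : ∀ x, 0 ≤ f x) :
    Fintype.card C * ∑ x, f x ^ 2 ≤ ∑ c : C, walsh f c * walsh f c := by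
  rw [sum_walsh_mul_walsh, Finset.mul_sum]
  refine Finset.sum_le_sum fun x _ => ?_
  refine le_trans (le_of_eq ?_) (Finset.single_le_sum (f := fun y => f x * f y *
    ∑ c : C, zmodTwoSign ((x + y) ⬝ᵥ (c : ι → ZMod 2))) (fun y _ => ?_) (Finset.mem_univ x))
  · have hx : x + x = 0 := by
      ext i; exact CharTwo.add_self_eq_zero (x i)
    simp only [hx, zero_dotProduct, zmodTwoSign_zero, Finset.sum_const, Finset.card_univ,
      nsmul_eq_mul, mul_one]
    ring
  · exact mul_nonneg (mul_nonneg (hf x) (hf y)) (sum_zmodTwoSign_dotProduct_nonneg C _)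

/-- A linear code whose minimum distance `d` is large compared with an approximate eigenvalue `l`
of the hypercube on a set `B` has at most `(n + 1) |B|` elements. -/
lemma card_le_of_cubeAdj_ge (C : Submodule (ZMod 2) (ι → ZMod 2)) {d l : ℝ}
    (hd : ∀ c ∈ C, c ≠ 0 → d ≤ hammingNorm c) (hl : 0 ≤ l)
    (hdl : Fintype.card ι + 1 ≤ l + 2 * d)
    {f : (ι → ZMod 2) → ℝ} (hf : ∀ x, 0 ≤ f x) (hA : ∀ x, l * f x ≤ cubeAdj f x)
    (B : Finset (ι → ZMod 2)) (hB : ∀ x, x ∉ B → f x = 0) {x₀ : ι → ZMod 2} (hx₀ : 0 < f x₀) :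
    (Nat.card C : ℝ) ≤ (Fintype.card ι + 1) * #B := by
  classical
  have := Fintype.ofFinite C
  set n : ℝ := (Fintype.card ι : ℝ)
  have hmono := sum_walsh_mul_walsh_mono C (g := fun x => l * f x) hf hA
  have hlin : ∀ y, walsh (fun x => l * f x) y = l * walsh f y := fun y => by
    simp only [walsh, Finset.mul_sum, mul_assoc]
  simp only [hlin, walsh_cubeAdj] at hmono
  have hterm : ∀ c : C, walsh f c * walsh f c + walsh f c * ((n - 2 * hammingNorm (c : ι → ZMod 2))
      * walsh f c) ≤ walsh f c * (l * walsh f c) +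
      (if c = 0 then (n + 1) * (∑ x, f x) ^ 2 else 0) := fun c => by
    split_ifs with hc
    · subst hc
      simp only [Submodule.coe_zero, hammingNorm_zero, walsh_zero, Nat.cast_zero]
      nlinarith [mul_nonneg hl (sq_nonneg (∑ x, f x))]
    · have h1 := hd c c.2 (by simpa using hc)
      nlinarith [mul_self_nonneg (walsh f c)]
  have hsum := Finset.sum_le_sum fun c (_ : c ∈ (Finset.univ : Finset C)) => hterm c
  rw [Finset.sum_add_distrib, Finset.sum_add_distrib, Finset.sum_ite_eq' Finset.univ (0 : C),
    if_pos (Finset.mem_univ _)] at hsum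
  have hlow := card_mul_sum_sq_le_sum_walsh_sq C hf
  have hcs : (∑ x, f x) ^ 2 ≤ #B * ∑ x, f x ^ 2 := by
    have h1 : ∑ x ∈ B, f x = ∑ x, f x :=
      Finset.sum_subset (Finset.subset_univ _) fun x _ hx => hB x hx
    rw [← h1]
    refine sq_sum_le_card_mul_sum_sq.trans ?_
    exact mul_le_mul_of_nonneg_left (Finset.sum_le_sum_of_subset_of_nonneg
      (Finset.subset_univ _) fun _ _ _ => sq_nonneg _) (Nat.cast_nonneg _)
  have hpos : 0 < ∑ x, f x ^ 2 :=
    Finset.sum_pos' (fun _ _ => sq_nonneg _) ⟨x₀, Finset.mem_univ _, by positivity⟩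
  have hn : 0 ≤ n + 1 := by positivity
  rw [Nat.card_eq_fintype_card]
  refine le_of_mul_le_mul_right ?_ hpos
  nlinarith [mul_le_mul_of_nonneg_left hcs hn]

lemma hammingNorm_add_single (x : ι → ZMod 2) (i : ι) :
    hammingNorm (x + Pi.single i 1) =
      if x i = 0 then hammingNorm x + 1 else hammingNorm x - 1 := by
  have h01 : ∀ a : ZMod 2, a ≠ 0 → a + 1 = 0 := by decide
  unfold hammingNorm
  split_ifs with hi
  · rw [← Finset.card_insert_of_notMem (a := i) (by simp [hi])]
    congr 1
    ext j
    rcases eq_or_ne j i with rfl | hj <;> simp_all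
  · rw [← Finset.card_erase_of_mem (a := i) (by simp [hi])]
    congr 1
    ext j
    rcases eq_or_ne j i with rfl | hj <;> simp_all

lemma cubeAdj_comp_hammingNorm (g : ℕ → ℝ) (x : ι → ZMod 2) :
    cubeAdj (fun y => g (hammingNorm y)) x = hammingNorm x * g (hammingNorm x - 1) +
      (Fintype.card ι - hammingNorm x) * g (hammingNorm x + 1) := by
  have h : ∀ i, g (hammingNorm (x + Pi.single i 1)) = g (hammingNorm x + 1) +
      (if x i ≠ 0 then 1 else 0) * (g (hammingNorm x - 1) - g (hammingNorm x + 1)) := fun i => by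
    rw [hammingNorm_add_single]
    by_cases hi : x i = 0 <;> simp [hi]
  simp only [cubeAdj, h, Finset.sum_add_distrib, ← Finset.sum_mul, Finset.sum_boole]
  simp only [Finset.sum_const, Finset.card_univ, nsmul_eq_mul, hammingNorm]
  ring

/-- A nonnegative radial function supported on the levels `l, …, r` of the hypercube and satisfying
a pointwise eigenvalue inequality. -/
lemma exists_cubeAdj_ge {l r : ℕ} (hl : 1 ≤ l) (hlr : l ≤ r)
    (hr : r ≤ Fintype.card ι) {t κ ev : ℝ} (ht : 0 < t) (hκ : 0 ≤ κ) (hκl : κ * t ≤ l)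
    (hκr : κ ≤ (Fintype.card ι - r) * t) (hev : ev * (r - l + 1) ≤ 2 * κ * (r - l)) :
    ∃ f : (ι → ZMod 2) → ℝ, (∀ x, 0 ≤ f x) ∧ (∀ x, r < hammingNorm x → f x = 0) ∧
      (∃ x, 0 < f x) ∧ ∀ x, ev * f x ≤ cubeAdj f x := by
  set g : ℕ → ℝ := fun w =>
    if l ≤ w ∧ w ≤ r then t ^ w * (((w : ℝ) + 1 - l) * (r + 1 - w)) else 0 with hg
  have hformula : ∀ w, l ≤ w + 1 → w ≤ r + 1 →
      g w = t ^ w * (((w : ℝ) + 1 - l) * (r + 1 - w)) := fun w h1 h2 => by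
    simp only [hg]
    split_ifs with h
    · rfl
    · rcases (by omega : l = w + 1 ∨ w = r + 1) with rfl | rfl <;> simp
  have hpos : ∀ w, l ≤ w → w ≤ r → 0 < g w := fun w h1 h2 => by
    have h1' : (l : ℝ) ≤ w := by exact_mod_cast h1
    have h2' : (w : ℝ) ≤ r := by exact_mod_cast h2
    rw [hformula w (by omega) (by omega)]
    have h3 : 0 < (w : ℝ) + 1 - l := by linarith
    have h4 : 0 < (r : ℝ) + 1 - w := by linarith
    positivity
  have hzero : ∀ w, ¬ (l ≤ w ∧ w ≤ r) → g w = 0 := fun w h => if_neg h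
  have hnonneg : ∀ w, 0 ≤ g w := fun w => by
    by_cases h : l ≤ w ∧ w ≤ r
    · exact (hpos w h.1 h.2).le
    · exact (hzero w h).ge
  refine ⟨fun x => g (hammingNorm x), fun x => hnonneg _, fun x hx => hzero _ (by omega), ?_,
    fun x => ?_⟩
  · obtain ⟨x, hx⟩ := exists_hammingNorm_eq hr
    exact ⟨x, by simpa only [hx] using hpos r hlr le_rfl⟩
  rw [cubeAdj_comp_hammingNorm]
  dsimp only
  have hwn : hammingNorm x ≤ Fintype.card ι := hammingNorm_le_card_fintype
  generalize hammingNorm x = w at hwn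
  have hwn' : (w : ℝ) ≤ Fintype.card ι := by exact_mod_cast hwn
  by_cases h : l ≤ w ∧ w ≤ r
  · obtain ⟨v, rfl⟩ : ∃ v, w = v + 1 := ⟨w - 1, by omega⟩
    obtain ⟨h1, h2⟩ := h
    have h1' : (l : ℝ) ≤ v + 1 := by exact_mod_cast h1
    have h2' : (v : ℝ) + 1 ≤ r := by exact_mod_cast h2
    have hlow : κ * t * g v ≤ ((v + 1 : ℕ) : ℝ) * g v :=
      mul_le_mul_of_nonneg_right (by push_cast; linarith) (hnonneg _)
    have hhigh : κ * g (v + 2) ≤ (Fintype.card ι - ((v + 1 : ℕ) : ℝ)) * t * g (v + 2) := by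
      refine mul_le_mul_of_nonneg_right (hκr.trans ?_) (hnonneg _)
      exact mul_le_mul_of_nonneg_right (by push_cast; linarith) ht.le
    have hev' : 2 * κ ≤ (2 * κ - ev) * (((v : ℝ) + 2 - l) * (r - v)) := by
      have hm : (r : ℝ) - l + 1 ≤ ((v : ℝ) + 2 - l) * (r - v) := by
        nlinarith [mul_nonneg (sub_nonneg.2 h1') (sub_nonneg.2 h2')]
      have hk : 0 ≤ 2 * κ - ev := by
        by_contra hneg
        nlinarith
      nlinarith [mul_le_mul_of_nonneg_left hm hk]
    have hgv := hformula v (by omega) (by omega)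
    have hgv1 := hformula (v + 1) (by omega) (by omega)
    have hgv2 := hformula (v + 2) (by omega) (by omega)
    push_cast at hgv1 hgv2
    have hcalc : ev * g (v + 1) * t ≤ κ * t * g v * t + κ * g (v + 2) := by
      rw [hgv, hgv1, hgv2]
      have htt : 0 ≤ t ^ v * t ^ 2 := by positivity
      have := mul_le_mul_of_nonneg_left hev' htt
      ring_nf at this ⊢
      linarith
    refine le_of_mul_le_mul_right ?_ ht
    simp only [Nat.add_sub_cancel]
    nlinarith [mul_le_mul_of_nonneg_right hlow ht.le]
  · rw [hzero w h, mul_zero]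
    exact add_nonneg (mul_nonneg (Nat.cast_nonneg _) (hnonneg _))
      (mul_nonneg (by linarith) (hnonneg _))

lemma sum_pow_hammingNorm (u : ℝ) :
    ∑ x : ι → ZMod 2, u ^ hammingNorm x = (1 + u) ^ Fintype.card ι := by
  have h : ∑ a : ZMod 2, (if a ≠ 0 then u else 1) = 1 + u := by
    rw [show (Finset.univ : Finset (ZMod 2)) = {0, 1} from rfl]
    simp
  rw [← h, ← Finset.card_univ, ← Finset.prod_const, Finset.prod_univ_sum, Fintype.piFinset_univ]
  refine Finset.sum_congr rfl fun x _ => ?_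
  rw [Finset.prod_ite, Finset.prod_const, Finset.prod_const_one, mul_one, hammingNorm]

lemma pow_mul_card_hammingNorm_le {u : ℝ} (hu : 0 < u) (hu1 : u ≤ 1) (r : ℕ) :
    u ^ r * #{x : ι → ZMod 2 | hammingNorm x ≤ r} ≤ (1 + u) ^ Fintype.card ι := by
  rw [← sum_pow_hammingNorm, mul_comm, ← nsmul_eq_mul, ← Finset.sum_const]
  refine (Finset.sum_le_sum fun x hx => ?_).trans (Finset.sum_le_sum_of_subset_of_nonneg
    (Finset.subset_univ _) fun x _ _ => by positivity)
  exact pow_le_pow_of_le_one hu.le hu1 (Finset.mem_filter.1 hx).2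

end Walsh

open Filter in
lemma eventually_succ_pow_mul_pow_lt {A D : ℝ} (hA : 0 ≤ A) (hAD : A < D) (Q : ℕ) :
    ∀ᶠ n : ℕ in atTop, ((n : ℝ) + 1) ^ Q * A ^ n < D ^ n := by
  rcases hA.eq_or_lt with rfl | hA
  · filter_upwards [eventually_ge_atTop 1] with n hn
    rw [zero_pow (by omega), mul_zero]
    positivity
  have hD : 0 < D := hA.trans hAD
  have hθ : 0 < A / D := by positivity
  have h := (tendsto_pow_const_mul_const_pow_of_lt_one Q hθ.le ((div_lt_one hD).2 hAD)).comp
    (tendsto_add_atTop_nat 1)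
  filter_upwards [h.eventually_lt_const hθ] with n hn
  simp only [Function.comp_apply, pow_succ, ← mul_assoc] at hn
  push_cast at hn
  have h1 : ((n : ℝ) + 1) ^ Q * (A / D) ^ n < 1 := by
    refine lt_of_mul_lt_mul_right ?_ hθ.le
    linarith
  rwa [div_pow, ← mul_div_assoc, div_lt_one (by positivity)] at h1

/-- A non-asymptotic form of the first linear programming bound for binary linear codes. -/
lemma pow_finrank_le_of_lt_hammingNorm {ι : Type*} [Fintype ι]
    (C : Submodule (ZMod 2) (ι → ZMod 2)) {a b δ t μ u n : ℝ} (hn : n = Fintype.card ι)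
    (ha : 0 < a) (hab : a < b) (hb1 : b ≤ 1) (ht : 0 < t) (hμ : 0 ≤ μ) (hμa : μ * t ≤ a)
    (hμb : μ ≤ (1 - b) * t) (hδ : δ ≤ 1 / 2) (hμδ : 1 < 2 * μ + 2 * δ)
    (hu : 0 < u) (hu1 : u ≤ 1) (hn1 : 1 ≤ n)
    (hn2 : (2 * μ + 2 * δ - 1) + (b - a) + 2 * μ ≤ n * ((2 * μ + 2 * δ - 1) * (b - a)))
    (hn3 : 2 ≤ n * (b - a)) (hC : ∀ c ∈ C, c ≠ 0 → δ * n < hammingNorm c) :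
    u ^ ⌊b * n⌋₊ * 2 ^ Module.finrank (ZMod 2) C ≤ (n + 1) * (1 + u) ^ Fintype.card ι := by
  classical
  have hbn : 0 ≤ b * n := mul_nonneg (by linarith) (by linarith)
  have han : 0 < a * n := mul_pos ha (by linarith)
  set r := ⌊b * n⌋₊
  set l := ⌈a * n⌉₊
  have hr1 : (r : ℝ) ≤ b * n := Nat.floor_le hbn
  have hr2 : b * n < r + 1 := Nat.lt_floor_add_one _
  have hl1 : a * n ≤ l := Nat.le_ceil _
  have hl2 : (l : ℝ) < a * n + 1 := Nat.ceil_lt_add_one han.le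
  have hlr : l ≤ r := by
    have : (l : ℝ) < r + 1 := by linarith
    exact Nat.lt_succ_iff.1 (by exact_mod_cast this)
  have hrn : r ≤ Fintype.card ι := by
    have : (r : ℝ) ≤ Fintype.card ι := by
      rw [← hn]
      exact hr1.trans (mul_le_of_le_one_left (by linarith) hb1)
    exact_mod_cast this
  have hev : (n + 1 - 2 * (δ * n)) * ((r : ℝ) - l + 1) ≤ 2 * (μ * n) * (r - l) := by
    have hm : n * (b - a) - 1 ≤ (r : ℝ) - l + 1 := by linarith
    have hεn : 0 ≤ n * (2 * μ + 2 * δ - 1) - 1 := by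
      by_contra! hneg
      have := mul_le_mul_of_nonneg_right hneg.le (sub_pos.2 hab).le
      linarith
    have h1 := mul_le_mul_of_nonneg_left hm hεn
    have h2 := mul_le_mul_of_nonneg_left hn2 (by linarith : 0 ≤ n)
    linarith
  have hκl : μ * n * t ≤ l := by
    have := mul_le_mul_of_nonneg_right hμa (by linarith : 0 ≤ n)
    linarith
  have hκr : μ * n ≤ (Fintype.card ι - r) * t := by
    rw [← hn]
    calc μ * n ≤ (1 - b) * t * n := by gcongr
      _ = (n - b * n) * t := by ring
      _ ≤ (n - r) * t := by gcongr
  have hδn : δ * n ≤ 1 / 2 * n := by gcongr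
  obtain ⟨f, hf, hfr, ⟨x₀, hx₀⟩, hA⟩ := exists_cubeAdj_ge (ι := ι)
    (Nat.one_le_ceil_iff.2 han) hlr hrn ht (by positivity : 0 ≤ μ * n) hκl hκr hev
  have hcard := card_le_of_cubeAdj_ge C (d := δ * n) (l := n + 1 - 2 * (δ * n))
    (fun c hc hc0 => (hC c hc hc0).le) (by linarith) (by rw [← hn]; linarith) hf hA
    {x : ι → ZMod 2 | hammingNorm x ≤ r} (fun x hx => hfr x (by simpa using hx)) hx₀
  have hball := pow_mul_card_hammingNorm_le (ι := ι) hu hu1 r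
  rw [Module.natCard_eq_pow_finrank (K := ZMod 2), Nat.card_zmod, ← hn] at hcard
  push_cast at hcard
  calc u ^ r * 2 ^ Module.finrank (ZMod 2) C
      ≤ u ^ r * ((n + 1) * #{x : ι → ZMod 2 | hammingNorm x ≤ r}) := by gcongr
    _ = (n + 1) * (u ^ r * #{x : ι → ZMod 2 | hammingNorm x ≤ r}) := by ring
    _ ≤ _ := by gcongr

/-- An asymptotic form of the first linear programming bound for binary linear codes: under the
stated numerical conditions a long code of rate at least `P / Q` has relative minimum distance at
most `δ`. -/
lemma exists_hammingNorm_le_of_rate {a δ t μ u : ℝ} {P Q B : ℕ} (hQ : 0 < Q) (hBQ : B ≤ Q)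
    (ha : 0 < a) (haB : a < B / Q) (ht : 0 < t) (hμ : 0 ≤ μ) (hμa : μ * t ≤ a)
    (hμB : μ ≤ (1 - B / Q) * t) (hδ : δ ≤ 1 / 2) (hμδ : 1 < 2 * μ + 2 * δ)
    (hu : 0 < u) (hu1 : u ≤ 1) (hrate : (1 + u) ^ Q < u ^ B * 2 ^ P) :
    ∃ N : ℕ, ∀ (ι : Type) [Fintype ι], N ≤ Fintype.card ι →
      ∀ C : Submodule (ZMod 2) (ι → ZMod 2), P * Fintype.card ι ≤ Q * Module.finrank (ZMod 2) C →
        ∃ c ∈ C, c ≠ 0 ∧ (hammingNorm c : ℝ) ≤ δ * Fintype.card ι := by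
  have hQ' : (0 : ℝ) < Q := by exact_mod_cast hQ
  have hε0 : 0 < 2 * μ + 2 * δ - 1 := by linarith
  have hab : 0 < (B / Q : ℝ) - a := by linarith
  obtain ⟨N₁, hN₁⟩ := Filter.eventually_atTop.1
    (eventually_succ_pow_mul_pow_lt (by positivity) hrate Q)
  obtain ⟨N₂, hN₂⟩ := exists_nat_ge (((2 * μ + 2 * δ - 1) + (B / Q - a) + 2 * μ) /
    ((2 * μ + 2 * δ - 1) * (B / Q - a)))
  obtain ⟨N₃, hN₃⟩ := exists_nat_ge (2 / ((B / Q : ℝ) - a))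
  rw [div_le_iff₀ (by positivity)] at hN₂
  rw [div_le_iff₀ hab] at hN₃
  refine ⟨N₁ + N₂ + N₃ + 1, fun ι _ hN C hC => ?_⟩
  by_contra! hcon
  have hone := pow_finrank_le_of_lt_hammingNorm C rfl ha haB
    ((div_le_one hQ').2 (by exact_mod_cast hBQ)) ht hμ hμa hμB hδ hμδ hu hu1
    (by exact_mod_cast (by omega : 1 ≤ Fintype.card ι))
    (hN₂.trans (by gcongr; omega)) (hN₃.trans (by gcongr; omega)) hcon
  set n := Fintype.card ι
  set k := Module.finrank (ZMod 2) C
  set r := ⌊(B / Q : ℝ) * n⌋₊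
  have hrB : r * Q ≤ B * n := by
    have : (r : ℝ) * Q ≤ B * n := by
      calc (r : ℝ) * Q ≤ B / Q * n * Q := by
            gcongr
            exact Nat.floor_le (by positivity)
        _ = B * n := by field_simp
    exact_mod_cast this
  have hpow : (u ^ B * 2 ^ P) ^ n ≤ ((n : ℝ) + 1) ^ Q * ((1 + u) ^ Q) ^ n := by
    calc (u ^ B * 2 ^ P) ^ n = u ^ (B * n) * 2 ^ (P * n) := by rw [mul_pow, pow_mul, pow_mul]
      _ ≤ u ^ (r * Q) * 2 ^ (Q * k) :=
        mul_le_mul (pow_le_pow_of_le_one hu.le hu1 hrB) (pow_le_pow_right₀ one_le_two hC)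
          (by positivity) (by positivity)
      _ = (u ^ r * 2 ^ k) ^ Q := by rw [mul_pow, ← pow_mul, ← pow_mul, mul_comm Q k]
      _ ≤ ((n + 1) * (1 + u) ^ n) ^ Q := by gcongr
      _ = _ := by rw [mul_pow, ← pow_mul, ← pow_mul, mul_comm n Q]
  exact absurd (hN₁ n (by omega)) (not_lt.2 hpow)

lemma card_zeros_add_hammingNorm {ι : Type*} [Fintype ι] (x : ι → ZMod 2) :
    Fintype.card {i // x i = 0} + hammingNorm x = Fintype.card ι := by
  have h3 := Fintype.card_subtype_compl fun i => x i = 0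
  have h4 := Fintype.card_subtype_le fun i => x i = 0
  have h5 : hammingNorm x = Fintype.card {i // ¬ x i = 0} := (Fintype.card_subtype _).symm
  omega

/-- Shortening a linear code at the support of `x`: passing to the codewords vanishing there costs at
most `hammingNorm x` dimensions. -/
lemma exists_shortened_code {ι : Type*} [Fintype ι] (V : Submodule (ZMod 2) (ι → ZMod 2))
    (x : ι → ZMod 2) :
    ∃ (e : ({i // x i = 0} → ZMod 2) →ₗ[ZMod 2] (ι → ZMod 2))
      (C : Submodule (ZMod 2) ({i // x i = 0} → ZMod 2)),
      Function.Injective e ∧ (∀ y ∈ C, e y ∈ V) ∧ (∀ y i, x i ≠ 0 → e y i = 0) ∧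
      (∀ y (i : {i // x i = 0}), e y i = y i) ∧
      Module.finrank (ZMod 2) V ≤ Module.finrank (ZMod 2) C + hammingNorm x := by
  classical
  have hinj := Subtype.val_injective (p := fun i => x i = 0)
  set e := Function.ExtendByZero.linearMap (ZMod 2) (Subtype.val : {i // x i = 0} → ι)
  have he : Function.Injective e := Function.extend_injective hinj (0 : ι → ZMod 2)
  refine ⟨e, V.comap e, he, fun y hy => hy, fun y i hi => ?_,
    fun y i => hinj.extend_apply _ _ _, ?_⟩
  · exact Function.extend_apply' _ _ _ (fun ⟨j, hj⟩ => hi (hj ▸ j.2))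
  · have h1 := Submodule.finrank_sup_add_finrank_inf_eq (LinearMap.range e) V
    have h2 := Submodule.finrank_le (LinearMap.range e ⊔ V)
    rw [LinearMap.finrank_range_of_inj he, ← Submodule.map_comap_eq,
      ((V.comap e).equivMapOfInjective e he).finrank_eq.symm, Module.finrank_pi] at h1
    rw [Module.finrank_pi] at h2
    have h3 := card_zeros_add_hammingNorm x
    omega

lemma ne_of_disjoint_support {ι : Type*} {x y : ι → ZMod 2} (hx : x ≠ 0)
    (h : ∀ i, x i ≠ 0 → y i = 0) : x ≠ y := by
  rintro rfl
  exact hx (funext fun i => by_contra fun hi => hi (h i hi))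

/-- Three nonzero vectors with pairwise disjoint supports form a focal family with focus `0`. -/
lemma isFocalWithFocus_zero_of_disjoint_support {n : ℕ} {x y z : Fin n → ZMod 2}
    (hxy : ∀ i, x i ≠ 0 → y i = 0) (hxz : ∀ i, x i ≠ 0 → z i = 0)
    (hyz : ∀ i, y i ≠ 0 → z i = 0) : IsFocalWithFocus 0 ![x, y, z] := by
  intro i j j' hj hj'
  have h1 := hxy i
  have h2 := hxz i
  have h3 := hyz i
  fin_cases j <;> fin_cases j' <;> simp_all

/-- There is `N` such that for all `n ≥ N`: every linear subspace of `𝔽₂^n` of dimension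
at least `0.44 n` contains `4` distinct vectors forming a focal family of size `4`. -/
theorem linear_subspace_focal_family :
    ∃ N : ℕ, ∀ n : ℕ, N ≤ n →
      ∀ V : Submodule (ZMod 2) (Fin n → ZMod 2),
        (0.44 : ℝ) * (n : ℝ) ≤ (Module.finrank (ZMod 2) V : ℝ) →
        ∃ x₀ ∈ V, ∃ xs : Fin 3 → Fin n → ZMod 2,
          (∀ j, xs j ∈ V) ∧ Function.Injective xs ∧ (∀ j, xs j ≠ x₀) ∧
          IsFocalWithFocus x₀ xs := by
  obtain ⟨N₁, hN₁⟩ := exists_hammingNorm_le_of_rate (a := 0.0899) (δ := 0.2145) (t := 0.3145)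
    (μ := 0.2858) (u := 9 / 91) (P := 44) (Q := 100) (B := 9) (by norm_num) (by norm_num)
    (by norm_num) (by norm_num) (by norm_num) (by norm_num) (by norm_num) (by norm_num)
    (by norm_num) (by norm_num) (by norm_num) (by norm_num) (by norm_num)
  obtain ⟨N₂, hN₂⟩ := exists_hammingNorm_le_of_rate (a := 0.0498) (δ := 0.285) (t := 0.2294)
    (μ := 0.217) (u := 1 / 19) (P := 86) (Q := 300) (B := 15) (by norm_num) (by norm_num)
    (by norm_num) (by norm_num) (by norm_num) (by norm_num) (by norm_num) (by norm_num)
    (by norm_num) (by norm_num) (by norm_num) (by norm_num) (by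
      rw [show (300 : ℕ) = 100 * 3 from rfl, pow_mul]
      norm_num)
  refine ⟨N₁ + 2 * N₂ + 1, fun n hn V hV => ?_⟩
  have hn0 : (1 : ℝ) ≤ n := by exact_mod_cast (by omega : 1 ≤ n)
  obtain ⟨x, hxV, hx0, hx⟩ := hN₁ (Fin n) (by simpa using (by omega : N₁ ≤ n)) V (by
    have : (44 : ℝ) * n ≤ 100 * Module.finrank (ZMod 2) V := by linarith
    simpa using (by exact_mod_cast this))
  obtain ⟨e, C, he, heV, hezero, hecoe, hC⟩ := exists_shortened_code V x
  have hcard := card_zeros_add_hammingNorm x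
  rw [Fintype.card_fin] at hcard hx
  have hcard' : (Fintype.card {i // x i = 0} : ℝ) + hammingNorm x = n := by exact_mod_cast hcard
  have hC' : (Module.finrank (ZMod 2) V : ℝ) ≤ Module.finrank (ZMod 2) C + hammingNorm x := by
    exact_mod_cast hC
  obtain ⟨y, hyC, hy0, hy⟩ := hN₂ {i // x i = 0} (by
      have : (N₂ : ℝ) ≤ Fintype.card {i // x i = 0} := by
        have : (2 : ℝ) * N₂ ≤ n := by exact_mod_cast (by omega : 2 * N₂ ≤ n)
        linarith
      exact_mod_cast this) C (by
    have : (86 : ℝ) * Fintype.card {i // x i = 0} ≤ 300 * Module.finrank (ZMod 2) C := by linarith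
    exact_mod_cast this)
  obtain ⟨e', D, he', heC, hezero', hecoe', hD⟩ := exists_shortened_code C y
  have hD' : (Module.finrank (ZMod 2) C : ℝ) ≤ Module.finrank (ZMod 2) D + hammingNorm y := by
    exact_mod_cast hD
  have hDpos : D ≠ ⊥ := by
    rintro rfl
    rw [finrank_bot, Nat.cast_zero] at hD'
    linarith
  obtain ⟨z, hzD, hz0⟩ := D.exists_mem_ne_zero_of_ne_bot hDpos
  have hey0 : e y ≠ 0 := (map_ne_zero_iff e he).2 hy0
  have hez0 : e (e' z) ≠ 0 := (map_ne_zero_iff e he).2 ((map_ne_zero_iff e' he').2 hz0)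
  have hyz : ∀ i, e y i ≠ 0 → e (e' z) i = 0 := fun i hi => by
    have hxi : x i = 0 := by_contra fun h => hi (hezero y i h)
    have hyi : y ⟨i, hxi⟩ ≠ 0 := by rwa [← hecoe y ⟨i, hxi⟩]
    exact (hecoe (e' z) ⟨i, hxi⟩).trans (hezero' z _ hyi)
  have hxy_ne := ne_of_disjoint_support hx0 (hezero y)
  have hxz_ne := ne_of_disjoint_support hx0 (hezero (e' z))
  have hyz_ne := ne_of_disjoint_support hey0 hyz
  refine ⟨0, V.zero_mem, ![x, e y, e (e' z)], ?_, ?_, ?_,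
    isFocalWithFocus_zero_of_disjoint_support (hezero y) (hezero (e' z)) hyz⟩
  · intro j
    fin_cases j
    exacts [hxV, heV y hyC, heV _ (heC z hzD)]
  · intro j j' h
    fin_cases j <;> fin_cases j'
    exacts [rfl, absurd h hxy_ne, absurd h hxz_ne, absurd h hxy_ne.symm, rfl, absurd h hyz_ne,
      absurd h hxz_ne.symm, absurd h hyz_ne.symm, rfl]
  · intro j
    fin_cases j
    exacts [hx0, hey0, hez0]
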